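/- For all real numbers u and s, the function D ↦ D * (sqrt(D^2 + (u - s)^2) - sqrt(D^2 + u^2) + s * u / sqrt(D^2 + u^2)) tends to s^2 / 2 as D tends to infinity. In particular, the error of the far-field linear approximation of the distance difference is asymptotically s^2/(2D) as the measuring distance D grows. -/

import Mathlib

open Filter

/-- The hypotenuse over a leg `D` and a fixed leg `c` is asymptotic to `D`. -/
theorem tendsto_sqrt_sq_add_sq_div_self (c : ℝ) :
    Tendsto (fun D : ℝ => Real.sqrt (D ^ 2 + c ^ 2) / D) atTop (nhds 1) := by
  have hlim : Tendsto (fun D : ℝ => Real.sqrt (1 + (c / D) ^ 2)) atTop (nhds 1) := by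
    have hc : Tendsto (fun D : ℝ => c / D) atTop (nhds 0) :=
      tendsto_const_nhds.div_atTop tendsto_id
    simpa using ((hc.pow 2).const_add 1).sqrt
  refine hlim.congr' ?_
  filter_upwards [eventually_gt_atTop 0] with D hD
  have hsq : 1 + (c / D) ^ 2 = (D ^ 2 + c ^ 2) / D ^ 2 := by field_simp
  rw [hsq, Real.sqrt_div (by positivity), Real.sqrt_sq hD.le]

/-- Sharp asymptotics of the far-field linearization error: as `D → ∞`,
`D * (sqrt(D^2 + (u - s)^2) - sqrt(D^2 + u^2) + s*u/sqrt(D^2 + u^2))` tends to `s^2/2`,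
i.e. the error of the linear far-field approximation is asymptotically `s^2/(2D)`. -/
theorem farfield_linearization_error_asymptotics (u s : ℝ) :
    Tendsto
      (fun D : ℝ =>
        D * (Real.sqrt (D ^ 2 + (u - s) ^ 2) - Real.sqrt (D ^ 2 + u ^ 2) +
          s * u / Real.sqrt (D ^ 2 + u ^ 2)))
      atTop (nhds (s ^ 2 / 2)) := by
  have hA := tendsto_sqrt_sq_add_sq_div_self (u - s)
  have hB := tendsto_sqrt_sq_add_sq_div_self u
  have hlim := ((tendsto_const_nhds (x := s ^ 2 - 2 * s * u)).div (hA.add hB) (by norm_num)).add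
    ((tendsto_const_nhds (x := s * u)).div hB one_ne_zero)
  rw [show (s ^ 2 - 2 * s * u) / (1 + 1) + s * u / 1 = s ^ 2 / 2 by ring] at hlim
  refine hlim.congr' ?_
  filter_upwards [eventually_gt_atTop 0] with D hD
  have hApos : 0 < Real.sqrt (D ^ 2 + (u - s) ^ 2) := by positivity
  have hBpos : 0 < Real.sqrt (D ^ 2 + u ^ 2) := by positivity
  have hAsq := Real.sq_sqrt (show 0 ≤ D ^ 2 + (u - s) ^ 2 by positivity)
  have hBsq := Real.sq_sqrt (show 0 ≤ D ^ 2 + u ^ 2 by positivity)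
  simp only [Pi.div_apply]
  generalize Real.sqrt (D ^ 2 + (u - s) ^ 2) = A at *
  generalize Real.sqrt (D ^ 2 + u ^ 2) = B at *
  have hdiff : A - B = (s ^ 2 - 2 * s * u) / (A + B) := by
    rw [eq_div_iff (by positivity)]
    linear_combination hAsq - hBsq
  rw [hdiff, ← add_div]
  field_simp
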